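/- Let σ be a finite sequence of natural numbers in sawtooth form. If P is an unpierced hexagon of type 2 of G(σ) that is not empty, then G(σ) contains an unpierced box, an unpierced hexagon of type 1, or an unpierced hexagon of type 2 that is strictly inside P. -/

import Mathlib

/-- A finite sequence of natural numbers is in sawtooth form if whenever an entry
is less than the next one, the next one is exactly one more. -/
def Sawtooth (σ : List ℕ) : Prop :=
  ∀ i : ℕ, i + 1 < σ.length →
    σ.getD i 0 < σ.getD (i + 1) 0 → σ.getD (i + 1) 0 = σ.getD i 0 + 1

/-- A commutation swaps two adjacent entries whose values differ by more than 1. -/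
def Commutation (σ τ : List ℕ) : Prop :=
  ∃ (l r : List ℕ) (x y : ℕ),
    (x + 1 < y ∨ y + 1 < x) ∧ σ = l ++ x :: y :: r ∧ τ = l ++ y :: x :: r

/-- `(i, j)` is a dot of the dot graph `G(σ)` (the first coordinate is 1-based). -/
def IsDot (σ : List ℕ) (i j : ℤ) : Prop :=
  ∃ k : Fin σ.length, i = ((k : ℕ) : ℤ) + 1 ∧ j = ((σ.get k : ℕ) : ℤ)

/-- The dots `(a, y), (a+1, y+1), …, (a+t, y+t)` all belong to `G(σ)`; equivalently
(for `0 ≤ t`) the dots `(a, y)` and `(a+t, y+t)` lie on a common ascending segment. -/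
def OnAsc (σ : List ℕ) (a y t : ℤ) : Prop :=
  ∀ s : ℤ, 0 ≤ s → s ≤ t → IsDot σ (a + s) (y + s)

/-- The dots `(a, y), …, (a+m, y+m)` form an entire (i.e. maximal) ascending segment. -/
def IsAscSeg (σ : List ℕ) (a y : ℤ) (m : ℕ) : Prop :=
  OnAsc σ a y (m : ℤ) ∧ ¬ IsDot σ (a - 1) (y - 1) ∧
    ¬ IsDot σ (a + (m : ℤ) + 1) (y + (m : ℤ) + 1)

/-- A box of `G(σ)` with lower horizontal edge from `(a, y)` to `(b, y)` and
ascending edges of length `t`. -/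
def IsBox (σ : List ℕ) (a b y t : ℤ) : Prop :=
  0 ≤ t ∧ a + t < b ∧
  OnAsc σ a y t ∧ ¬ IsDot σ (a + t + 1) (y + t + 1) ∧
  OnAsc σ b y t ∧ ¬ IsDot σ (b - 1) (y - 1)

/-- No dot of `G(σ)` lies in the open interior of either horizontal edge of the box. -/
def BoxUnpierced (σ : List ℕ) (a b y t : ℤ) : Prop :=
  (∀ i : ℤ, a < i → i < b → ¬ IsDot σ i y) ∧
  (∀ i : ℤ, a + t < i → i < b + t → ¬ IsDot σ i (y + t))

/-- No dot of `G(σ)` lies in the open interior of the box. -/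
def BoxEmpty (σ : List ℕ) (a b y t : ℤ) : Prop :=
  ∀ i h : ℤ, y < h → h < y + t → a + (h - y) < i → i < b + (h - y) → ¬ IsDot σ i h

/-- The closed region of the box. -/
def BoxRegion (a b y t : ℤ) : Set (ℤ × ℤ) :=
  {p | y ≤ p.2 ∧ p.2 ≤ y + t ∧ a + (p.2 - y) ≤ p.1 ∧ p.1 ≤ b + (p.2 - y)}

/-- A hexagon of type 1 of `G(σ)`. -/
def IsHex1 (σ : List ℕ) (a b c y L M : ℤ) : Prop :=
  0 ≤ M ∧ M ≤ L ∧ a < b ∧ b + M < c ∧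
  OnAsc σ a y L ∧ ¬ IsDot σ (a + L + 1) (y + L + 1) ∧
  OnAsc σ b y M ∧ ¬ IsDot σ (b - 1) (y - 1) ∧ ¬ IsDot σ (b + M + 1) (y + M + 1) ∧
  OnAsc σ c (y + M) (L - M)

/-- No dot of `G(σ)` lies in the open interior of any of the three horizontal
edges of the type 1 hexagon. -/
def Hex1Unpierced (σ : List ℕ) (a b c y L M : ℤ) : Prop :=
  (∀ i : ℤ, a < i → i < b → ¬ IsDot σ i y) ∧
  (∀ i : ℤ, b + M < i → i < c → ¬ IsDot σ i (y + M)) ∧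
  (∀ i : ℤ, a + L < i → i < c + L - M → ¬ IsDot σ i (y + L))

/-- The open interior of the type 1 hexagon. -/
def Hex1Interior (a b c y L M : ℤ) : Set (ℤ × ℤ) :=
  {p | y < p.2 ∧ p.2 < y + L ∧ a + (p.2 - y) < p.1 ∧
    (p.2 ≤ y + M → p.1 < b + (p.2 - y)) ∧ (y + M ≤ p.2 → p.1 < c + (p.2 - y - M))}

/-- No dot of `G(σ)` lies in the open interior of the type 1 hexagon. -/
def Hex1Empty (σ : List ℕ) (a b c y L M : ℤ) : Prop :=
  ∀ p ∈ Hex1Interior a b c y L M, ¬ IsDot σ p.1 p.2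

/-- The closed region of the type 1 hexagon (open interior together with its
horizontal and ascending edges). -/
def Hex1Region (a b c y L M : ℤ) : Set (ℤ × ℤ) :=
  {p | y ≤ p.2 ∧ p.2 ≤ y + L ∧ a + (p.2 - y) ≤ p.1 ∧
    (p.2 < y + M → p.1 ≤ b + (p.2 - y)) ∧ (y + M ≤ p.2 → p.1 ≤ c + (p.2 - y - M))}

/-- A hexagon of type 2 of `G(σ)`. -/
def IsHex2 (σ : List ℕ) (p q r y L M : ℤ) : Prop :=
  0 ≤ M ∧ M ≤ L ∧ p < q ∧ p + (L - M) < r ∧ r + M < q + L ∧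
  OnAsc σ p y (L - M) ∧
  OnAsc σ r (y + L - M) M ∧ ¬ IsDot σ (r - 1) (y + L - M - 1) ∧
    ¬ IsDot σ (r + M + 1) (y + L + 1) ∧
  OnAsc σ q y L ∧ ¬ IsDot σ (q - 1) (y - 1)

/-- No dot of `G(σ)` lies in the open interior of any of the three horizontal
edges of the type 2 hexagon. -/
def Hex2Unpierced (σ : List ℕ) (p q r y L M : ℤ) : Prop :=
  (∀ i : ℤ, p < i → i < q → ¬ IsDot σ i y) ∧
  (∀ i : ℤ, p + (L - M) < i → i < r → ¬ IsDot σ i (y + L - M)) ∧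
  (∀ i : ℤ, r + M < i → i < q + L → ¬ IsDot σ i (y + L))

/-- The open interior of the type 2 hexagon. -/
def Hex2Interior (p q r y L M : ℤ) : Set (ℤ × ℤ) :=
  {x | y < x.2 ∧ x.2 < y + L ∧ x.1 < q + (x.2 - y) ∧
    (x.2 ≤ y + L - M → p + (x.2 - y) < x.1) ∧
    (y + L - M ≤ x.2 → r + (x.2 - y - L + M) < x.1)}

/-- No dot of `G(σ)` lies in the open interior of the type 2 hexagon. -/
def Hex2Empty (σ : List ℕ) (p q r y L M : ℤ) : Prop :=
  ∀ x ∈ Hex2Interior p q r y L M, ¬ IsDot σ x.1 x.2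

/-- The closed region of the type 2 hexagon (open interior together with its
horizontal and ascending edges). -/
def Hex2Region (p q r y L M : ℤ) : Set (ℤ × ℤ) :=
  {x | y ≤ x.2 ∧ x.2 ≤ y + L ∧ x.1 ≤ q + (x.2 - y) ∧
    (x.2 ≤ y + L - M → p + (x.2 - y) ≤ x.1) ∧
    (y + L - M < x.2 → r + (x.2 - y - L + M) ≤ x.1)}

/-- The number of dots of `G(σ)` lying in a region `R`. -/
noncomputable def DotsIn (σ : List ℕ) (R : Set (ℤ × ℤ)) : ℕ :=
  {p : ℤ × ℤ | IsDot σ p.1 p.2 ∧ p ∈ R}.ncard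

/-- A region `RQ` is strictly inside a region `RP` (with respect to `G(σ)`) if
`RQ ⊆ RP` and `RQ` contains strictly fewer dots of `G(σ)` than `RP`. -/
def StrictlyInside (σ : List ℕ) (RQ RP : Set (ℤ × ℤ)) : Prop :=
  RQ ⊆ RP ∧ DotsIn σ RQ < DotsIn σ RP

/-- A dot graph polygon: a box, a hexagon of type 1, or a hexagon of type 2. -/
inductive DGPoly : Type where
  | box (a b y t : ℤ)
  | hex1 (a b c y L M : ℤ)
  | hex2 (p q r y L M : ℤ)

/-- The polygon is genuinely a box/hexagon of type 1/hexagon of type 2 of `G(σ)`. -/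
def DGPoly.Valid (σ : List ℕ) : DGPoly → Prop
  | .box a b y t => IsBox σ a b y t
  | .hex1 a b c y L M => IsHex1 σ a b c y L M
  | .hex2 p q r y L M => IsHex2 σ p q r y L M

/-- The polygon is unpierced. -/
def DGPoly.Unpierced (σ : List ℕ) : DGPoly → Prop
  | .box a b y t => BoxUnpierced σ a b y t
  | .hex1 a b c y L M => Hex1Unpierced σ a b c y L M
  | .hex2 p q r y L M => Hex2Unpierced σ p q r y L M

/-- The polygon is empty. -/
def DGPoly.IsEmpty (σ : List ℕ) : DGPoly → Prop
  | .box a b y t => BoxEmpty σ a b y t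
  | .hex1 a b c y L M => Hex1Empty σ a b c y L M
  | .hex2 p q r y L M => Hex2Empty σ p q r y L M

/-- The closed region of the polygon. -/
def DGPoly.Region : DGPoly → Set (ℤ × ℤ)
  | .box a b y t => BoxRegion a b y t
  | .hex1 a b c y L M => Hex1Region a b c y L M
  | .hex2 p q r y L M => Hex2Region p q r y L M

theorem IsDot.unique {σ : List ℕ} {i j k : ℤ} (hj : IsDot σ i j) (hk : IsDot σ i k) : j = k := by
  obtain ⟨u, hu, rfl⟩ := hj
  obtain ⟨v, hv, rfl⟩ := hk
  have : u = v := Fin.ext (by omega)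
  rw [this]

/-- Every column lying between two columns with dots has a dot. -/
theorem IsDot.exists_of_between {σ : List ℕ} {i j k u v : ℤ} (hi : IsDot σ i u) (hk : IsDot σ k v)
    (hij : i ≤ j) (hjk : j ≤ k) : ∃ w, IsDot σ j w := by
  obtain ⟨a, ha, -⟩ := hi
  obtain ⟨b, hb, -⟩ := hk
  have hlt := b.isLt
  exact ⟨_, ⟨(j - 1).toNat, by omega⟩, by dsimp only; omega, rfl⟩

theorem Sawtooth.height_succ_le {σ : List ℕ} (hσ : Sawtooth σ) {i u v : ℤ}
    (hu : IsDot σ i u) (hv : IsDot σ (i + 1) v) : v ≤ u + 1 := by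
  obtain ⟨⟨a, ha⟩, hia, rfl⟩ := hu
  obtain ⟨⟨b, hb⟩, hib, rfl⟩ := hv
  dsimp only at hia hib
  obtain rfl : b = a + 1 := by omega
  have h := hσ a hb
  rw [List.getD_eq_getElem _ _ ha, List.getD_eq_getElem _ _ hb] at h
  simp only [List.get_eq_getElem]
  omega

/-- Going up, a sequence in sawtooth form skips no height. -/
theorem Sawtooth.exists_height {σ : List ℕ} (hσ : Sawtooth σ) {i j u v w : ℤ}
    (hij : i ≤ j) (hi : IsDot σ i u) (hj : IsDot σ j w) (huv : u ≤ v) (hvw : v ≤ w) :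
    ∃ x, i ≤ x ∧ x ≤ j ∧ IsDot σ x v := by
  induction j, hij using Int.leInduction generalizing w with
  | base =>
    have := hi.unique hj
    exact ⟨i, le_rfl, le_rfl, by rwa [show v = u by omega]⟩
  | succ j hij ih =>
    obtain ⟨k, hk⟩ := hi.exists_of_between hj hij (by omega)
    have := hσ.height_succ_le hk hj
    rcases eq_or_lt_of_le hvw with rfl | hlt
    · exact ⟨j + 1, by omega, le_rfl, hj⟩
    · obtain ⟨x, h1, h2, h3⟩ := ih hk (by omega)
      exact ⟨x, h1, by omega, h3⟩

theorem OnAsc.mono {σ : List ℕ} {a y t a' y' t' : ℤ} (h : OnAsc σ a y t) (ha : a ≤ a')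
    (hy : y' - y = a' - a) (ht : a' + t' ≤ a + t) : OnAsc σ a' y' t' := by
  intro s hs hst
  have := h (a' - a + s) (by omega) (by omega)
  convert this using 1 <;> omega

theorem OnAsc.height_eq {σ : List ℕ} {a y t i h : ℤ} (hasc : OnAsc σ a y t) (hd : IsDot σ i h)
    (h1 : a ≤ i) (h2 : i ≤ a + t) : h - y = i - a := by
  have h3 := hasc (i - a) (by omega) (by omega)
  rw [show a + (i - a) = i by ring] at h3
  have := hd.unique h3
  omega

theorem OnAsc.lt_of_lt {σ : List ℕ} {a b y t : ℤ} (ht : 0 ≤ t) (ha : OnAsc σ a y t)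
    (hb : OnAsc σ b y t) (hab : a < b) : a + t < b := by
  by_contra! hcon
  have h := hb 0 le_rfl ht
  rw [add_zero, add_zero] at h
  have := ha.height_eq h hab.le hcon
  omega

/-- An ascending run starting at a dot either reaches length `T` or ends earlier. -/
theorem onAsc_or_exists_end {σ : List ℕ} {a y : ℤ} (h : IsDot σ a y) (T : ℤ) :
    OnAsc σ a y T ∨ ∃ d, 0 ≤ d ∧ d < T ∧ OnAsc σ a y d ∧ ¬ IsDot σ (a + d + 1) (y + d + 1) := by
  by_cases hT : OnAsc σ a y T
  · exact .inl hT
  right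
  simp only [OnAsc, not_forall] at hT
  obtain ⟨s, hs⟩ := hT
  obtain ⟨m, ⟨hm0, hmT, hm⟩, hmin⟩ := Int.exists_least_of_bdd
    (P := fun s => 0 ≤ s ∧ s ≤ T ∧ ¬ IsDot σ (a + s) (y + s)) ⟨0, fun z hz => hz.1⟩
    ⟨s, hs.choose, hs.choose_spec.choose, hs.choose_spec.choose_spec⟩
  have hm1 : m ≠ 0 := by rintro rfl; exact hm (by simpa using h)
  refine ⟨m - 1, by omega, by omega, fun u hu0 hu => ?_, ?_⟩
  · by_contra hnd
    have := hmin u ⟨hu0, by omega, hnd⟩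
    omega
  · convert hm using 2 <;> ring

/-- An ascending run ending at a dot either has length at least `T` or starts later. -/
theorem onAsc_or_exists_start {σ : List ℕ} {x h : ℤ} (hx : IsDot σ x h) (T : ℤ) :
    OnAsc σ (x - T) (h - T) T ∨
      ∃ d, 0 ≤ d ∧ d < T ∧ OnAsc σ (x - d) (h - d) d ∧ ¬ IsDot σ (x - d - 1) (h - d - 1) := by
  by_cases hT : OnAsc σ (x - T) (h - T) T
  · exact .inl hT
  right
  simp only [OnAsc, not_forall] at hT
  obtain ⟨s, hs0, hsT, hs⟩ := hT
  obtain ⟨m, ⟨hm0, hmT, hm⟩, hmin⟩ := Int.exists_least_of_bdd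
    (P := fun s => 0 ≤ s ∧ s ≤ T ∧ ¬ IsDot σ (x - s) (h - s)) ⟨0, fun z hz => hz.1⟩
    ⟨T - s, by omega, by omega, by convert hs using 2 <;> ring⟩
  have hm1 : m ≠ 0 := by rintro rfl; exact hm (by simpa using hx)
  refine ⟨m - 1, by omega, by omega, fun u hu0 hu => ?_, ?_⟩
  · by_contra hnd
    have := hmin (m - 1 - u) ⟨by omega, by omega, by convert hnd using 2 <;> ring⟩
    omega
  · convert hm using 2 <;> ring

theorem exists_first_dot {σ : List ℕ} {a b i h : ℤ} (ha : a < i) (hb : i < b)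
    (hi : IsDot σ i h) :
    ∃ n, a < n ∧ n < b ∧ IsDot σ n h ∧ ∀ j, a < j → j < n → ¬ IsDot σ j h := by
  obtain ⟨n, ⟨h1, h2, h3⟩, hmin⟩ := Int.exists_least_of_bdd
    (P := fun n => a < n ∧ n < b ∧ IsDot σ n h) ⟨a, fun z hz => hz.1.le⟩ ⟨i, ha, hb, hi⟩
  refine ⟨n, h1, h2, h3, fun j hj1 hj2 hj => ?_⟩
  have := hmin j ⟨hj1, by omega, hj⟩
  omega

theorem exists_last_dot {σ : List ℕ} {a b i h : ℤ} (ha : a < i) (hb : i < b)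
    (hi : IsDot σ i h) :
    ∃ n, a < n ∧ n < b ∧ IsDot σ n h ∧ ∀ j, n < j → j < b → ¬ IsDot σ j h := by
  obtain ⟨n, ⟨h1, h2, h3⟩, hmax⟩ := Int.exists_greatest_of_bdd
    (P := fun n => a < n ∧ n < b ∧ IsDot σ n h) ⟨b, fun z hz => hz.2.1.le⟩ ⟨i, ha, hb, hi⟩
  refine ⟨n, h1, h2, h3, fun j hj1 hj2 hj => ?_⟩
  have := hmax j ⟨by omega, hj2, hj⟩
  omega

/-- A box at least one of whose horizontal edges is not pierced contains an unpierced box. -/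
theorem exists_unpierced_box {σ : List ℕ} {a b y t : ℤ} (hbox : IsBox σ a b y t)
    (hedge : (∀ i, a < i → i < b → ¬ IsDot σ i y) ∨
      (∀ i, a + t < i → i < b + t → ¬ IsDot σ i (y + t))) :
    ∃ a' b' y' t', a ≤ a' ∧ b' + t' ≤ b + t ∧ IsBox σ a' b' y' t' ∧
      BoxUnpierced σ a' b' y' t' := by
  induction hn : (b - a).toNat using Nat.strong_induction_on generalizing a b y t with
  | _ n ih =>
  subst hn
  by_cases hunp : BoxUnpierced σ a b y t
  · exact ⟨a, b, y, t, le_rfl, le_rfl, hbox, hunp⟩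
  obtain ⟨ht, hab, ha, hatop, hb, hbbot⟩ := hbox
  rcases hedge with hbot | htop
  · have hex : ∃ i, a + t < i ∧ i < b + t ∧ IsDot σ i (y + t) := by
      by_contra! hcon
      exact hunp ⟨hbot, hcon⟩
    obtain ⟨i, hi1, hi2, hi⟩ := hex
    obtain ⟨n, hn1, hn2, hn, hfirst⟩ := exists_first_dot hi1 hi2 hi
    have hnb : n < b := by
      by_contra! hcon
      have := hb.height_eq hn hcon hn2.le
      omega
    rcases onAsc_or_exists_start hn t with hrun | ⟨d, hd0, hdt, hrun, hnext⟩
    · have := hrun 0 le_rfl ht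
      exact absurd (by convert this using 1; ring) (hbot (n - t + 0) (by omega) (by omega))
    · have ha' : OnAsc σ (a + t - d) (y + t - d) d := ha.mono (by omega) (by omega) (by omega)
      have hlt := ha'.lt_of_lt hd0 hrun (by omega)
      obtain ⟨a', b', y', t', h1, h2, h3⟩ := ih (n - d - (a + t - d)).toNat (by omega)
        (a := a + t - d) (b := n - d) (y := y + t - d) (t := d)
        ⟨hd0, hlt, ha', by convert hatop using 2 <;> ring, hrun, hnext⟩
        (.inr fun j hj1 hj2 hj => hfirst j (by omega) (by omega) (by convert hj using 1; ring)) rfl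
      exact ⟨a', b', y', t', by omega, by omega, h3⟩
  · have hex : ∃ i, a < i ∧ i < b ∧ IsDot σ i y := by
      by_contra! hcon
      exact hunp ⟨hcon, htop⟩
    obtain ⟨i, hi1, hi2, hi⟩ := hex
    obtain ⟨m, hm1, hm2, hm, hlast⟩ := exists_last_dot hi1 hi2 hi
    have hma : a + t < m := by
      by_contra! hcon
      have := ha.height_eq hm hm1.le hcon
      omega
    rcases onAsc_or_exists_end hm t with hrun | ⟨d, hd0, hdt, hrun, hnext⟩
    · exact absurd (hrun t ht le_rfl) (htop (m + t) (by omega) (by omega))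
    · have hb' : OnAsc σ b y d := hb.mono le_rfl (by omega) (by omega)
      obtain ⟨a', b', y', t', h1, h2, h3⟩ := ih (b - m).toNat (by omega)
        (a := m) (b := b) (y := y) (t := d)
        ⟨hd0, hrun.lt_of_lt hd0 hb' hm2, hrun, hnext, hb', hbbot⟩ (.inl hlast) rfl
      exact ⟨a', b', y', t', by omega, by omega, h3⟩

/-- Between the columns `A` and `B` there is an unpierced box, or an ascending segment `(a, y, t)`
such that neither the ray going left from its lowest dot nor the ray going right from its highest
dot meets a dot. -/
theorem exists_unpierced_box_or_free_segment {σ : List ℕ} {A B i h : ℤ}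
    (hA : A < i) (hB : i < B) (hi : IsDot σ i h)
    (hleft : ∀ j k, IsDot σ (A + 1) j → IsDot σ A k → j ≠ k + 1)
    (hright : ∀ j k, IsDot σ (B - 1) j → IsDot σ B k → k ≠ j + 1) :
    (∃ a b y t, A < a ∧ b + t < B ∧ IsBox σ a b y t ∧ BoxUnpierced σ a b y t) ∨
    ∃ a y t, 0 ≤ t ∧ A < a ∧ a + t < B ∧ OnAsc σ a y t ∧
      ¬ IsDot σ (a - 1) (y - 1) ∧ ¬ IsDot σ (a + t + 1) (y + t + 1) ∧
      (∀ j, A < j → j < a → ¬ IsDot σ j y) ∧ (∀ j, a + t < j → j < B → ¬ IsDot σ j (y + t)) := by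
  obtain ⟨t, ⟨ht, a, y, haA, haB, hasc⟩, hmax⟩ := Int.exists_greatest_of_bdd
    (P := fun t => 0 ≤ t ∧ ∃ a y, A < a ∧ a + t < B ∧ OnAsc σ a y t)
    ⟨B - A, fun z ⟨_, a, y, h1, h2, _⟩ => by omega⟩
    ⟨0, le_rfl, i, h, hA, by omega, fun s h0 h1 => by
      obtain rfl : s = 0 := by omega
      simpa using hi⟩
  have hfirst : IsDot σ a y := by simpa using hasc 0 le_rfl ht
  have hlong : ∀ a' y', A < a' → a' + (t + 1) < B → ¬ OnAsc σ a' y' (t + 1) := by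
    intro a' y' h1 h2 h3
    have := hmax (t + 1) ⟨by omega, a', y', h1, h2, h3⟩
    omega
  have hbot : ¬ IsDot σ (a - 1) (y - 1) := by
    intro hd
    rcases eq_or_lt_of_le (show A ≤ a - 1 by omega) with heq | hlt
    · rw [← heq] at hd
      exact hleft y _ (by rwa [show A + 1 = a by omega]) hd (by ring)
    · refine hlong (a - 1) (y - 1) hlt (by omega) fun s hs0 hs => ?_
      rcases eq_or_lt_of_le hs0 with rfl | hs1
      · simpa using hd
      · convert hasc (s - 1) (by omega) (by omega) using 1 <;> ring
  have htop : ¬ IsDot σ (a + t + 1) (y + t + 1) := by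
    intro hd
    rcases eq_or_lt_of_le (show a + t + 1 ≤ B by omega) with heq | hlt
    · rw [heq] at hd
      exact hright (y + t) _ (by rw [show B - 1 = a + t by omega]; exact hasc t ht le_rfl) hd rfl
    · refine hlong a y haA (by omega) fun s hs0 hs => ?_
      rcases eq_or_lt_of_le hs with rfl | hs1
      · convert hd using 1 <;> ring
      · exact hasc s hs0 (by omega)
  by_cases hl : ∀ j, A < j → j < a → ¬ IsDot σ j y
  · by_cases hr : ∀ j, a + t < j → j < B → ¬ IsDot σ j (y + t)
    · exact .inr ⟨a, y, t, ht, haA, haB, hasc, hbot, htop, hl, hr⟩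
    left
    push Not at hr
    obtain ⟨j, hj1, hj2, hj⟩ := hr
    obtain ⟨x, hx1, hx2, hx, hxfirst⟩ := exists_first_dot hj1 hj2 hj
    rcases onAsc_or_exists_start hx (t + 1) with hrun | ⟨d, hd0, hdt, hrun, hnext⟩
    · have hrun' : OnAsc σ (x - t) y t := hrun.mono (by omega) (by omega) (by omega)
      have := hasc.lt_of_lt ht hrun' (by omega)
      exact absurd hrun (hlong _ _ (by omega) (by omega))
    · have ha' : OnAsc σ (a + t - d) (y + t - d) d := hasc.mono (by omega) (by omega) (by omega)
      obtain ⟨a', b', y', t', h1, h2, h3⟩ := exists_unpierced_box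
        (a := a + t - d) (b := x - d) (y := y + t - d) (t := d)
        ⟨hd0, ha'.lt_of_lt hd0 hrun (by omega), ha', by convert htop using 2 <;> ring, hrun, hnext⟩
        (.inr fun j hj1 hj2 hj =>
          hxfirst j (by omega) (by omega) (by convert hj using 1; ring))
      exact ⟨a', b', y', t', by omega, by omega, h3⟩
  · left
    push Not at hl
    obtain ⟨j, hj1, hj2, hj⟩ := hl
    obtain ⟨x, hx1, hx2, hx, hxlast⟩ := exists_last_dot hj1 hj2 hj
    rcases onAsc_or_exists_end hx (t + 1) with hrun | ⟨d, hd0, hdt, hrun, hnext⟩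
    · have hrun' : OnAsc σ x y t := hrun.mono le_rfl (by omega) (by omega)
      have := hrun'.lt_of_lt ht hasc hx2
      exact absurd hrun (hlong _ _ hx1 (by omega))
    · have ha' : OnAsc σ a y d := hasc.mono le_rfl (by omega) (by omega)
      obtain ⟨a', b', y', t', h1, h2, h3⟩ := exists_unpierced_box
        (a := x) (b := a) (y := y) (t := d)
        ⟨hd0, hrun.lt_of_lt hd0 ha' hx2, hrun, hnext, ha', hbot⟩ (.inl hxlast)
      exact ⟨a', b', y', t', by omega, by omega, h3⟩

theorem finite_setOf_isDot (σ : List ℕ) : {p : ℤ × ℤ | IsDot σ p.1 p.2}.Finite := by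
  refine (Set.finite_range fun k : Fin σ.length =>
    (((k : ℕ) : ℤ) + 1, ((σ.get k : ℕ) : ℤ))).subset ?_
  rintro ⟨i, j⟩ ⟨k, hi, hj⟩
  exact ⟨k, Prod.ext hi.symm hj.symm⟩

theorem StrictlyInside.of_dot {σ : List ℕ} {R S : Set (ℤ × ℤ)} {x h : ℤ} (hRS : R ⊆ S)
    (hd : IsDot σ x h) (hS : (x, h) ∈ S) (hR : (x, h) ∉ R) : StrictlyInside σ R S :=
  ⟨hRS, Set.ncard_lt_ncard
    ⟨fun _ hp => ⟨hp.1, hRS hp.2⟩, fun hsub => hR (hsub (a := (x, h)) ⟨hd, hS⟩).2⟩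
    ((finite_setOf_isDot σ).subset fun _ hp => hp.1)⟩

/-- If `P` is an unpierced hexagon of type 2 of `G(σ)` that is not
empty, then `G(σ)` contains an unpierced box, an unpierced hexagon of type 1, or an
unpierced hexagon of type 2 that is strictly inside `P`. -/
theorem unpierced_hex2_not_empty (σ : List ℕ) (hsaw : Sawtooth σ)
    (p q r y L M : ℤ) (hhex : IsHex2 σ p q r y L M)
    (hunp : Hex2Unpierced σ p q r y L M) (hne : ¬ Hex2Empty σ p q r y L M) :
    ∃ Q : DGPoly, Q.Valid σ ∧ Q.Unpierced σ ∧
      StrictlyInside σ Q.Region (Hex2Region p q r y L M) := by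
  obtain ⟨hM, hML, hpq, hpr, hrq, hp, hr, hrbot, hrtop, hq, hqbot⟩ := hhex
  obtain ⟨hunp_bot, hunp_mid, hunp_top⟩ := hunp
  have hdp : IsDot σ p y := by simpa using hp 0 le_rfl (by omega)
  have hdr : IsDot σ r (y + L - M) := by simpa using hr 0 le_rfl hM
  have hdq : IsDot σ q y := by simpa using hq 0 le_rfl (by omega)
  have hdrtop : IsDot σ (r + M) (y + L) := by
    convert hr M hM le_rfl using 1; ring
  have hdqtop : IsDot σ (q + L) (y + L) := hq L (by omega) le_rfl
  have hrMq : r + M < q := by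
    by_contra! hcon
    rcases le_or_gt q r with hle | hlt
    · have := hq.height_eq hdr hle (by omega)
      omega
    · have := hr.height_eq hdq hlt.le hcon
      omega
  have habove : ∀ i h, p + (L - M) < i → i < r → IsDot σ i h → y + L - M < h := by
    intro i h h1 h2 hd
    by_contra! hcon
    obtain ⟨k, hk⟩ := hd.exists_of_between hdr (j := r - 1) (by omega) (by omega)
    have hk1 := hsaw.height_succ_le hk (by rwa [sub_add_cancel])
    have hk2 : k ≠ y + L - M - 1 := by rintro rfl; exact hrbot hk
    obtain ⟨x, hx1, hx2, hx⟩ := hsaw.exists_height (by omega) hd hk hcon (by omega)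
    exact hunp_mid x (by omega) (by omega) hx
  have hinside : ∀ i h, r + M < i → i < q → IsDot σ i h → y < h ∧ h < y + L := by
    intro i h h1 h2 hd
    constructor <;> by_contra! hcon
    · obtain ⟨k, hk⟩ := hd.exists_of_between hdq (j := q - 1) (by omega) (by omega)
      have hk1 := hsaw.height_succ_le hk (by rwa [sub_add_cancel])
      have hk2 : k ≠ y - 1 := by rintro rfl; exact hqbot hk
      obtain ⟨x, hx1, hx2, hx⟩ := hsaw.exists_height (by omega) hd hk hcon (by omega)
      exact hunp_bot x (by omega) (by omega) hx
    · obtain ⟨k, hk⟩ := hdrtop.exists_of_between hd (j := r + M + 1) (by omega) (by omega)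
      have hk1 := hsaw.height_succ_le hdrtop hk
      have hk2 : k ≠ y + L + 1 := by rintro rfl; exact hrtop hk
      obtain ⟨x, hx1, hx2, hx⟩ := hsaw.exists_height (by omega) hk hd (by omega) hcon
      exact hunp_top x (by omega) (by omega) hx
  obtain ⟨i, h, hi1, hi2, hi⟩ : ∃ i h, r + M < i ∧ i < q ∧ IsDot σ i h := by
    simp only [Hex2Empty, not_forall, not_not] at hne
    obtain ⟨⟨i, h⟩, ⟨h1, h2, h3, h4, h5⟩, hd⟩ := hne
    dsimp only at h1 h2 h3 h4 h5 hd
    refine ⟨i, h, ?_, ?_, hd⟩ <;> by_contra! hcon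
    · rcases le_or_gt r i with hri | hri
      · have := hr.height_eq hd hri hcon
        omega
      · have h6 : p + (L - M) < i := by
          by_contra! hip
          have := hp.height_eq hd (by omega) hip
          omega
        have := habove i h h6 hri hd
        omega
    · have := hq.height_eq hd hcon (by omega)
      omega
  rcases exists_unpierced_box_or_free_segment hi1 hi2 hi
    (fun j k hj hk hjk => hrtop (by
      rw [hdrtop.unique hk, ← hjk]; exact hj))
    (fun j k hj hk hjk => hqbot (by
      rw [hdq.unique hk, hjk, add_sub_cancel_right]; exact hj)) with
    ⟨a, b, Y, t, ha, hb, hbox, hbunp⟩ |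
    ⟨a, Y, t, ht, ha, hat, hasc, hbot, htop, hleft, hright⟩
  · refine ⟨.box a b Y t, hbox, hbunp, .of_dot ?_ hdq ?_ ?_⟩
    all_goals
      obtain ⟨ht, hab, hasc, -, hbsc, -⟩ := hbox
      have hY := hinside a Y ha (by omega) (by simpa using hasc 0 le_rfl ht)
      have hYt := hinside (a + t) (Y + t) (by omega) (by omega) (hasc t ht le_rfl)
    · rintro ⟨u, v⟩ ⟨h1, h2, h3, h4⟩
      dsimp only at h1 h2 h3 h4
      refine ⟨?_, ?_, ?_, ?_, ?_⟩ <;> dsimp only <;> omega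
    · refine ⟨?_, ?_, ?_, ?_, ?_⟩ <;> dsimp only <;> omega
    · rintro ⟨h1, -⟩
      dsimp only at h1
      omega
  have hY := hinside a Y ha (by omega) (by simpa using hasc 0 le_rfl ht)
  have hYt := hinside (a + t) (Y + t) (by omega) (by omega) (hasc t ht le_rfl)
  have hright' : ∀ i, a + t < i → i < q + (Y + t - y) → ¬ IsDot σ i (Y + t) := by
    intro i h1 h2 hd
    rcases lt_or_ge i q with hiq | hiq
    · exact hright i h1 hiq hd
    · have := hq.height_eq hd hiq (by omega)
      omega
  rcases lt_or_ge Y (y + L - M) with hlow | hhigh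
  · refine ⟨.hex2 p q a y (Y + t - y) t,
      ⟨ht, by omega, hpq, by omega, by omega, hp.mono le_rfl (by omega) (by omega),
        hasc.mono le_rfl (by omega) le_rfl, ?_, ?_, hq.mono le_rfl (by omega) (by omega), hqbot⟩,
      ⟨hunp_bot, ?_, ?_⟩, .of_dot ?_ hdqtop ?_ ?_⟩
    · convert hbot using 2; ring
    · convert htop using 2; ring
    · intro i h1 h2 hd
      rw [show y + (Y + t - y) - t = Y by ring] at hd
      rcases le_or_gt i (p + (L - M)) with h3 | h3
      · have := hp.height_eq hd (by omega) h3
        omega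
      rcases lt_or_ge i r with h4 | h4
      · have := habove i Y h3 h4 hd
        omega
      rcases le_or_gt i (r + M) with h5 | h5
      · have := hr.height_eq hd h4 h5
        omega
      · exact hleft i h5 h2 hd
    · intro i h1 h2 hd
      exact hright' i h1 h2 (by convert hd using 1; ring)
    · rintro ⟨u, v⟩ ⟨h1, h2, h3, h4, h5⟩
      dsimp only at h1 h2 h3 h4 h5
      refine ⟨?_, ?_, ?_, ?_, ?_⟩ <;> dsimp only <;> omega
    · refine ⟨?_, ?_, ?_, ?_, ?_⟩ <;> dsimp only <;> omega
    · rintro ⟨-, h2, -⟩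
      dsimp only at h2
      omega
  · refine ⟨.hex1 (r + (Y - y - L + M)) a (q + (Y + t - y)) Y (y + L - Y) t,
      ⟨ht, by omega, by omega, by omega, hr.mono (by omega) (by omega) (by omega), ?_,
        hasc, hbot, htop, hq.mono (by omega) (by omega) (by omega)⟩,
      ⟨?_, hright', ?_⟩, .of_dot ?_ hdq ?_ ?_⟩
    · convert hrtop using 2 <;> ring
    · intro i h1 h2 hd
      rcases le_or_gt i (r + M) with h3 | h3
      · have := hr.height_eq hd (by omega) h3
        omega
      · exact hleft i h3 h2 hd
    · intro i h1 h2 hd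
      exact hunp_top i (by omega) (by omega) (by convert hd using 1; ring)
    · rintro ⟨u, v⟩ ⟨h1, h2, h3, h4, h5⟩
      dsimp only at h1 h2 h3 h4 h5
      refine ⟨?_, ?_, ?_, ?_, ?_⟩ <;> dsimp only <;> omega
    · refine ⟨?_, ?_, ?_, ?_, ?_⟩ <;> dsimp only <;> omega
    · rintro ⟨h1, -⟩
      dsimp only at h1
      omega
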